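/- For every κ with 0 ≤ κ < π²/2 there exists a minimal graph f : 𝔻 → ℝ over the open unit disk with f(0,0) = 0, f_u(0,0) = f_v(0,0) = 0 (so the unit normal at the origin is (0,0,1)), f_uv(0,0) = 0 (the graph bends in the coordinate directions at the origin), and whose Gaussian curvature at the origin satisfies |K(0,0)| = κ exactly. -/

import Mathlib

open Real

/-- The open unit disk in `ℝ × ℝ`. -/
def unitDisk : Set (ℝ × ℝ) := {p : ℝ × ℝ | p.1 ^ 2 + p.2 ^ 2 < 1}

/-- Partial derivative with respect to the first coordinate `u`. -/
noncomputable def pu (f : ℝ × ℝ → ℝ) (p : ℝ × ℝ) : ℝ :=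
  deriv (fun u : ℝ => f (u, p.2)) p.1

/-- Partial derivative with respect to the second coordinate `v`. -/
noncomputable def pv (f : ℝ × ℝ → ℝ) (p : ℝ × ℝ) : ℝ :=
  deriv (fun v : ℝ => f (p.1, v)) p.2

/-- `f : 𝔻 → ℝ` is a minimal graph over the open unit disk: it is `C²` there and
    satisfies the minimal surface equation. -/
def IsMinimalGraph (f : ℝ × ℝ → ℝ) : Prop :=
  ContDiffOn ℝ 2 f unitDisk ∧
    ∀ p ∈ unitDisk,
      (1 + (pv f p) ^ 2) * pu (pu f) p
        - 2 * pu f p * pv f p * pv (pu f) p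
        + (1 + (pu f p) ^ 2) * pv (pv f) p = 0

/-- The even quartic `1 + 2 q x² + x⁴` is positive for `-1 < q`. -/
theorem quartic_pos {q : ℝ} (hq : -1 < q) (x : ℝ) : 0 < 1 + 2 * q * x ^ 2 + x ^ 4 := by
  nlinarith [sq_nonneg (x ^ 2 - 1), mul_nonneg (sub_nonneg.2 hq.le) (sq_nonneg x),
    sq_nonneg x, sq_nonneg (x ^ 2)]

theorem hasDerivAt_sqrt_quartic {q : ℝ} (hq : -1 < q) (x : ℝ) :
    HasDerivAt (fun x : ℝ => √(1 + 2 * q * x ^ 2 + x ^ 4))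
      ((2 * q * x + 2 * x ^ 3) / √(1 + 2 * q * x ^ 2 + x ^ 4)) x := by
  have h : HasDerivAt (fun x : ℝ => 1 + 2 * q * x ^ 2 + x ^ 4) (4 * q * x + 4 * x ^ 3) x := by
    have h2 := (hasDerivAt_pow 2 x).const_mul (2 * q)
    have h4 := hasDerivAt_pow 4 x
    exact ((h2.const_add 1).add h4).congr_deriv (by norm_num; ring)
  convert h.sqrt (quartic_pos hq x).ne' using 1
  have := (sqrt_pos.2 (quartic_pos hq x)).ne'
  field_simp
  ring

theorem contDiff_sqrt_quartic {q : ℝ} (hq : -1 < q) {n : WithTop ℕ∞} :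
    ContDiff ℝ n (fun x : ℝ => √(1 + 2 * q * x ^ 2 + x ^ 4)) :=
  ContDiff.sqrt (by fun_prop) fun x => (quartic_pos hq x).ne'

/-- The elliptic integral `F(c) = m ∫₀ᶜ ds / √(1 + 2 q s² + s⁴)`, as a `C²` function. -/
theorem exists_primitive_quartic {q : ℝ} (hq : -1 < q) (m : ℝ) :
    ∃ F : ℝ → ℝ, F 0 = 0 ∧ ContDiff ℝ 2 F ∧
      ∀ x, HasStrictDerivAt F (m / √(1 + 2 * q * x ^ 2 + x ^ 4)) x := by
  have hc : ContDiff ℝ 1 (fun x : ℝ => m / √(1 + 2 * q * x ^ 2 + x ^ 4)) :=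
    contDiff_const.div (contDiff_sqrt_quartic hq) fun x => (sqrt_pos.2 (quartic_pos hq x)).ne'
  have hd : ∀ x, HasStrictDerivAt
      (fun x => ∫ s in (0 : ℝ)..x, m / √(1 + 2 * q * s ^ 2 + s ^ 4))
      (m / √(1 + 2 * q * x ^ 2 + x ^ 4)) x :=
    fun x => hc.continuous.integral_hasStrictDerivAt 0 x
  refine ⟨_, by simp, ?_, hd⟩
  rw [show (2 : WithTop ℕ∞) = 1 + 1 by norm_num, contDiff_succ_iff_deriv]
  refine ⟨fun x => (hd x).hasDerivAt.differentiableAt, by simp, ?_⟩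
  rwa [funext fun x => (hd x).hasDerivAt.deriv]

/-- For `0 ≤ p ≤ 1` the solution of `A' = √(1 + 2 p A² + A⁴)`, `A(0) = 0` (an elliptic function,
equal to `tan` for `p = 1`) exists at least on the interval `(-π/2, π/2)`. -/
theorem exists_elliptic_tangent {p : ℝ} (hp0 : 0 ≤ p) (hp1 : p ≤ 1) :
    ∃ A : ℝ → ℝ, A 0 = 0 ∧ ContDiffOn ℝ 2 A (Set.Ioo (-(π / 2)) (π / 2)) ∧
      ∀ x ∈ Set.Ioo (-(π / 2)) (π / 2),
        HasDerivAt A (√(1 + 2 * p * A x ^ 2 + A x ^ 4)) x := by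
  have hp : -1 < p := by linarith
  obtain ⟨Φ, hΦ0, -, hΦ⟩ := exists_primitive_quartic hp 1
  have hpos : ∀ x, 0 < √(1 + 2 * p * x ^ 2 + x ^ 4) := fun x => sqrt_pos.2 (quartic_pos hp x)
  have hmono : StrictMono Φ := strictMono_of_hasDerivAt_pos (fun x => (hΦ x).hasDerivAt)
    fun x => by have := hpos x; positivity
  have hcont : Continuous Φ := continuous_iff_continuousAt.2 fun x => (hΦ x).hasDerivAt.continuousAt
  have harctan : Monotone fun x => Φ x - arctan x := by
    refine monotone_of_hasDerivAt_nonneg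
      (fun x => (hΦ x).hasDerivAt.sub (hasDerivAt_arctan x)) fun x => ?_
    refine sub_nonneg.2 (one_div_le_one_div_of_le (hpos x) ?_)
    refine sqrt_le_iff.2 ⟨by positivity, ?_⟩
    nlinarith [mul_nonneg (sub_nonneg.2 hp1) (sq_nonneg x)]
  have hleft : Function.LeftInverse (Function.invFun Φ) Φ :=
    Function.leftInverse_invFun hmono.injective
  have hrange : ∀ x ∈ Set.Ioo (-(π / 2)) (π / 2), ∃ a, Φ a = x := by
    intro x hx
    have habs : |x| < π / 2 := abs_lt.2 hx
    have ht : 0 ≤ tan |x| := tan_nonneg_of_nonneg_of_le_pi_div_two (abs_nonneg x) habs.le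
    have hat : arctan (tan |x|) = |x| :=
      arctan_tan (by linarith [abs_nonneg x, pi_pos]) habs
    have h1 := harctan ht
    have h2 := harctan (neg_nonpos.2 ht)
    simp only [hΦ0, arctan_zero, arctan_neg, hat] at h1 h2
    have hx' : x ∈ Set.Icc (Φ (-tan |x|)) (Φ (tan |x|)) :=
      ⟨by linarith [neg_abs_le x], by linarith [le_abs_self x]⟩
    obtain ⟨a, -, ha⟩ :=
      intermediate_value_Icc (show -tan |x| ≤ tan |x| by linarith) hcont.continuousOn hx'
    exact ⟨a, ha⟩
  have hderiv : ∀ x ∈ Set.Ioo (-(π / 2)) (π / 2), HasDerivAt (Function.invFun Φ)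
      (√(1 + 2 * p * Function.invFun Φ x ^ 2 + Function.invFun Φ x ^ 4)) x := by
    intro x hx
    obtain ⟨a, rfl⟩ := hrange x hx
    have := (hΦ a).to_local_left_inverse (one_div_ne_zero (hpos a).ne')
      (Filter.Eventually.of_forall hleft)
    rw [hleft a]
    simpa using this.hasDerivAt
  refine ⟨Function.invFun Φ, by simpa [hΦ0] using hleft 0, ?_, hderiv⟩
  have hbootstrap : ∀ n : ℕ, ContDiffOn ℝ n (Function.invFun Φ) (Set.Ioo (-(π / 2)) (π / 2)) := by
    intro n
    induction n with
    | zero =>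
      exact contDiffOn_zero.2 fun x hx => (hderiv x hx).continuousAt.continuousWithinAt
    | succ n ih =>
      push_cast
      rw [contDiffOn_succ_iff_deriv_of_isOpen isOpen_Ioo]
      refine ⟨fun x hx => (hderiv x hx).differentiableAt.differentiableWithinAt, by simp, ?_⟩
      exact ((contDiff_sqrt_quartic hp).comp_contDiffOn ih).congr
        fun x hx => (hderiv x hx).deriv
  exact_mod_cast hbootstrap 2

section Disk

theorem isOpen_unitDisk : IsOpen unitDisk :=
  isOpen_lt (by fun_prop) continuous_const

theorem pu_congr {f g : ℝ × ℝ → ℝ} (h : ∀ q ∈ unitDisk, f q = g q) {p : ℝ × ℝ}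
    (hp : p ∈ unitDisk) : pu f p = pu g p := by
  refine Filter.EventuallyEq.deriv_eq ?_
  have hc : ContinuousAt (fun u : ℝ => (u, p.2)) p.1 := by fun_prop
  filter_upwards [hc (isOpen_unitDisk.mem_nhds hp)] with u hu using h _ hu

theorem pv_congr {f g : ℝ × ℝ → ℝ} (h : ∀ q ∈ unitDisk, f q = g q) {p : ℝ × ℝ}
    (hp : p ∈ unitDisk) : pv f p = pv g p := by
  refine Filter.EventuallyEq.deriv_eq ?_
  have hc : ContinuousAt (fun v : ℝ => (p.1, v)) p.2 := by fun_prop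
  filter_upwards [hc (isOpen_unitDisk.mem_nhds hp)] with v hv using h _ hv

theorem mem_Ioo_of_mem_unitDisk {c r : ℝ} (hc : 2 * c ^ 2 = 1) (hr : 0 < r) {p : ℝ × ℝ}
    (hp : p ∈ unitDisk) :
    c * r * (p.1 + p.2) ∈ Set.Ioo (-r) r ∧ c * r * (p.1 - p.2) ∈ Set.Ioo (-r) r := by
  have hp' : p.1 ^ 2 + p.2 ^ 2 < 1 := hp
  have key : ∀ y : ℝ, y ^ 2 < 2 → c * r * y ∈ Set.Ioo (-r) r := by
    intro y hy
    refine abs_lt.1 (abs_lt_of_sq_lt_sq ?_ hr.le)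
    have hr2 : 0 < r ^ 2 := by positivity
    calc (c * r * y) ^ 2 = r ^ 2 * (y ^ 2 / 2) := by linear_combination r ^ 2 * y ^ 2 / 2 * hc
      _ < r ^ 2 := by nlinarith
  exact ⟨key _ (by nlinarith [sq_nonneg (p.1 - p.2)]),
    key _ (by nlinarith [sq_nonneg (p.1 + p.2)])⟩

end Disk

section Curve

variable {p q m σ τ x : ℝ} {F a b : ℝ → ℝ}

theorem hasDerivAt_sqrt_quartic_comp (hp : -1 < p)
    (ha : HasDerivAt a (σ * √(1 + 2 * p * a x ^ 2 + a x ^ 4)) x) :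
    HasDerivAt (fun x => √(1 + 2 * p * a x ^ 2 + a x ^ 4))
      (σ * (2 * p * a x + 2 * a x ^ 3)) x := by
  have h := (hasDerivAt_sqrt_quartic hp (a x)).comp x ha
  refine h.congr_deriv ?_
  have := (sqrt_pos.2 (quartic_pos hp (a x))).ne'
  field_simp

theorem hasDerivAt_inv_sqrt_quartic (hq : -1 < q) (m x : ℝ) :
    HasDerivAt (fun x : ℝ => m / √(1 + 2 * q * x ^ 2 + x ^ 4))
      (-(m / √(1 + 2 * q * x ^ 2 + x ^ 4)) * (2 * q * x + 2 * x ^ 3)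
        / (1 + 2 * q * x ^ 2 + x ^ 4)) x := by
  have hQ := quartic_pos hq x
  have h0 := (sqrt_pos.2 hQ).ne'
  refine ((hasDerivAt_const x m).div (hasDerivAt_sqrt_quartic hq x) h0).congr_deriv ?_
  have hs := sq_sqrt hQ.le
  generalize √(1 + 2 * q * x ^ 2 + x ^ 4) = s at *
  rw [← hs]
  field_simp
  ring

theorem hasDerivAt_comp_mul
    (hF : ∀ c, HasStrictDerivAt F (m / √(1 + 2 * q * c ^ 2 + c ^ 4)) c)
    (ha : HasDerivAt a (σ * √(1 + 2 * p * a x ^ 2 + a x ^ 4)) x)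
    (hb : HasDerivAt b (τ * √(1 + 2 * p * b x ^ 2 + b x ^ 4)) x) :
    HasDerivAt (fun x => F (a x * b x))
      (m / √(1 + 2 * q * (a x * b x) ^ 2 + (a x * b x) ^ 4) *
        (σ * (√(1 + 2 * p * a x ^ 2 + a x ^ 4) * b x)
          + τ * (a x * √(1 + 2 * p * b x ^ 2 + b x ^ 4)))) x := by
  refine ((hF (a x * b x)).hasDerivAt.comp x (ha.mul hb)).congr_deriv ?_
  ring

theorem hasDerivAt_gradient (hp : -1 < p) (hq : -1 < q) (ε : ℝ)
    (ha : HasDerivAt a (σ * √(1 + 2 * p * a x ^ 2 + a x ^ 4)) x)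
    (hb : HasDerivAt b (τ * √(1 + 2 * p * b x ^ 2 + b x ^ 4)) x) :
    HasDerivAt (fun x => m / √(1 + 2 * q * (a x * b x) ^ 2 + (a x * b x) ^ 4) *
        (√(1 + 2 * p * a x ^ 2 + a x ^ 4) * b x
          + ε * (a x * √(1 + 2 * p * b x ^ 2 + b x ^ 4))))
      (m / √(1 + 2 * q * (a x * b x) ^ 2 + (a x * b x) ^ 4) *
        (-(2 * q * (a x * b x) + 2 * (a x * b x) ^ 3)
            / (1 + 2 * q * (a x * b x) ^ 2 + (a x * b x) ^ 4) *
          (σ * (√(1 + 2 * p * a x ^ 2 + a x ^ 4) * b x)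
            + τ * (a x * √(1 + 2 * p * b x ^ 2 + b x ^ 4))) *
          (√(1 + 2 * p * a x ^ 2 + a x ^ 4) * b x
            + ε * (a x * √(1 + 2 * p * b x ^ 2 + b x ^ 4)))
        + (σ * ((2 * p * a x + 2 * a x ^ 3) * b x)
          + ε * τ * (a x * (2 * p * b x + 2 * b x ^ 3))
          + (τ + ε * σ) * (√(1 + 2 * p * a x ^ 2 + a x ^ 4)
            * √(1 + 2 * p * b x ^ 2 + b x ^ 4))))) x := by
  have h1 := (hasDerivAt_inv_sqrt_quartic hq m (a x * b x)).comp x (ha.mul hb)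
  have h2 := (hasDerivAt_sqrt_quartic_comp hp ha).mul hb
  have h3 := (ha.mul (hasDerivAt_sqrt_quartic_comp hp hb)).const_mul ε
  refine (h1.mul (h2.add h3)).congr_deriv ?_
  simp only [Function.comp_apply, Pi.mul_apply, Pi.add_apply]
  ring

end Curve

/-- The algebraic identity behind the minimal surface equation for `F(A(s) A(t))`. -/
theorem minimal_surface_identity {p q a b α β w φ c k : ℝ} (hq : q = 1 - 2 * p ^ 2)
    (hα : α ^ 2 = 1 + 2 * p * a ^ 2 + a ^ 4) (hβ : β ^ 2 = 1 + 2 * p * b ^ 2 + b ^ 4)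
    (hw : w * (1 + 2 * q * (a * b) ^ 2 + (a * b) ^ 4) = 1) (hφ : φ ^ 2 = 2 * p * w)
    (hc : 2 * c ^ 2 = 1) (ψ S T : ℝ) (hψ : ψ = -(2 * q * (a * b) + 2 * (a * b) ^ 3) * w)
    (hS : S = (2 * p * a + 2 * a ^ 3) * b) (hT : T = a * (2 * p * b + 2 * b ^ 3)) :
    (1 + (c * φ * (α * b - a * β)) ^ 2) *
        (c * k * φ * (ψ * (α * b + a * β) ^ 2 + (S + T + 2 * (α * β))))
      - 2 * (c * φ * (α * b + a * β)) * (c * φ * (α * b - a * β)) *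
        (c * k * φ * (ψ * (α * b + a * β) * (α * b - a * β) + (S - T)))
      + (1 + (c * φ * (α * b + a * β)) ^ 2) *
        (c * k * φ * (ψ * (α * b - a * β) ^ 2 + (S + T - 2 * (α * β)))) = 0 := by
  have core : ψ * (α ^ 2 * b ^ 2 + a ^ 2 * β ^ 2) + (S + T)
      + φ ^ 2 * (S * (a ^ 2 * β ^ 2) + T * (α ^ 2 * b ^ 2) - 2 * (a * b) * (α ^ 2 * β ^ 2))
      = 0 := by
    rw [hα, hβ, hφ, hψ, hS, hT]
    subst hq
    linear_combination -((2 * p * a + 2 * a ^ 3) * b + a * (2 * p * b + 2 * b ^ 3)) * hw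
  linear_combination 2 * c * k * φ * core + c * k * φ ^ 3 * 2 *
    (S * (a ^ 2 * β ^ 2) + T * (α ^ 2 * b ^ 2) - 2 * (a * b) * (α ^ 2 * β ^ 2)) * hc

/-- The function `F(A(s) A(t)) / r` with `s = c r (u + v)` and `t = c r (u - v)` is a minimal graph,
and its second derivatives at the origin are `2 c² r m`, `0`, `-2 c² r m`. -/
theorem isMinimalGraph_elliptic {p q m c r : ℝ} {F A : ℝ → ℝ} (hp : -1 < p) (hq1 : -1 < q)
    (hq : q = 1 - 2 * p ^ 2) (hm : m ^ 2 = 2 * p) (hc : 2 * c ^ 2 = 1) (hr : 0 < r)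
    (hFC : ContDiff ℝ 2 F)
    (hF : ∀ x, HasStrictDerivAt F (m / √(1 + 2 * q * x ^ 2 + x ^ 4)) x)
    (hA0 : A 0 = 0) (hAC : ContDiffOn ℝ 2 A (Set.Ioo (-r) r))
    (hA : ∀ x ∈ Set.Ioo (-r) r, HasDerivAt A (√(1 + 2 * p * A x ^ 2 + A x ^ 4)) x)
    {f : ℝ × ℝ → ℝ}
    (hf : f = fun z => F (A (c * r * (z.1 + z.2)) * A (c * r * (z.1 - z.2))) / r) :
    IsMinimalGraph f ∧ pu f (0, 0) = 0 ∧ pv f (0, 0) = 0 ∧ pu (pu f) (0, 0) = 2 * c ^ 2 * r * m ∧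
      pv (pu f) (0, 0) = 0 ∧ pv (pv f) (0, 0) = -(2 * c ^ 2 * r * m) := by
  have hmem := fun z (hz : z ∈ unitDisk) => mem_Ioo_of_mem_unitDisk hc hr hz
  have hsu : ∀ z ∈ unitDisk, HasDerivAt (fun u => A (c * r * (u + z.2)))
      (c * r * √(1 + 2 * p * A (c * r * (z.1 + z.2)) ^ 2 + A (c * r * (z.1 + z.2)) ^ 4)) z.1 := by
    intro z hz
    have h := (hA _ (hmem z hz).1).comp z.1 (((hasDerivAt_id z.1).add_const z.2).const_mul (c * r))
    exact h.congr_deriv (by ring)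
  have htu : ∀ z ∈ unitDisk, HasDerivAt (fun u => A (c * r * (u - z.2)))
      (c * r * √(1 + 2 * p * A (c * r * (z.1 - z.2)) ^ 2 + A (c * r * (z.1 - z.2)) ^ 4)) z.1 := by
    intro z hz
    have h := (hA _ (hmem z hz).2).comp z.1 (((hasDerivAt_id z.1).sub_const z.2).const_mul (c * r))
    exact h.congr_deriv (by ring)
  have hsv : ∀ z ∈ unitDisk, HasDerivAt (fun v => A (c * r * (z.1 + v)))
      (c * r * √(1 + 2 * p * A (c * r * (z.1 + z.2)) ^ 2 + A (c * r * (z.1 + z.2)) ^ 4)) z.2 := by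
    intro z hz
    have h := (hA _ (hmem z hz).1).comp z.2 (((hasDerivAt_id z.2).const_add z.1).const_mul (c * r))
    exact h.congr_deriv (by ring)
  have htv : ∀ z ∈ unitDisk, HasDerivAt (fun v => A (c * r * (z.1 - v)))
      (-(c * r) * √(1 + 2 * p * A (c * r * (z.1 - z.2)) ^ 2 + A (c * r * (z.1 - z.2)) ^ 4))
      z.2 := by
    intro z hz
    have h := (hA _ (hmem z hz).2).comp z.2 (((hasDerivAt_id z.2).const_sub z.1).const_mul (c * r))
    exact h.congr_deriv (by ring)
  let G : ℝ → ℝ × ℝ → ℝ := fun ε z =>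
    m / √(1 + 2 * q * (A (c * r * (z.1 + z.2)) * A (c * r * (z.1 - z.2))) ^ 2
        + (A (c * r * (z.1 + z.2)) * A (c * r * (z.1 - z.2))) ^ 4) *
      (√(1 + 2 * p * A (c * r * (z.1 + z.2)) ^ 2 + A (c * r * (z.1 + z.2)) ^ 4)
          * A (c * r * (z.1 - z.2))
        + ε * (A (c * r * (z.1 + z.2))
          * √(1 + 2 * p * A (c * r * (z.1 - z.2)) ^ 2 + A (c * r * (z.1 - z.2)) ^ 4)))
  have hpu : ∀ z ∈ unitDisk, pu f z = c * G 1 z := by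
    intro z hz
    rw [hf]
    refine (((hasDerivAt_comp_mul hF (hsu z hz) (htu z hz)).div_const r).congr_deriv ?_).deriv
    simp only [G]
    field_simp
  have hpv : ∀ z ∈ unitDisk, pv f z = c * G (-1) z := by
    intro z hz
    rw [hf]
    refine (((hasDerivAt_comp_mul hF (hsv z hz) (htv z hz)).div_const r).congr_deriv ?_).deriv
    simp only [G]
    field_simp
  have hGu := fun (ε : ℝ) (z : ℝ × ℝ) (hz : z ∈ unitDisk) =>
    ((hasDerivAt_gradient (m := m) hp hq1 ε (hsu z hz) (htu z hz)).const_mul c).deriv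
  have hGv := fun (ε : ℝ) (z : ℝ × ℝ) (hz : z ∈ unitDisk) =>
    ((hasDerivAt_gradient (m := m) hp hq1 ε (hsv z hz) (htv z hz)).const_mul c).deriv
  have hpuu := fun z hz => (pu_congr hpu hz).trans (hGu 1 z hz)
  have hpvu := fun z hz => (pv_congr hpu hz).trans (hGv 1 z hz)
  have hpvv := fun z hz => (pv_congr hpv hz).trans (hGv (-1) z hz)
  have h0 : ((0 : ℝ), (0 : ℝ)) ∈ unitDisk := by simp [unitDisk]
  refine ⟨⟨?_, fun z hz => ?_⟩, ?_, ?_, ?_, ?_, ?_⟩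
  · rw [hf]
    have hs : ContDiffOn ℝ 2 (fun z : ℝ × ℝ => A (c * r * (z.1 + z.2))) unitDisk :=
      hAC.comp (ContDiff.contDiffOn (by fun_prop)) fun z hz => (hmem z hz).1
    have ht : ContDiffOn ℝ 2 (fun z : ℝ × ℝ => A (c * r * (z.1 - z.2))) unitDisk :=
      hAC.comp (ContDiff.contDiffOn (by fun_prop)) fun z hz => (hmem z hz).2
    exact (hFC.comp_contDiffOn (hs.mul ht)).div_const r
  · rw [hpuu z hz, hpvu z hz, hpvv z hz, hpu z hz, hpv z hz]
    simp only [G]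
    generalize A (c * r * (z.1 + z.2)) = a
    generalize A (c * r * (z.1 - z.2)) = b
    have hα := sq_sqrt (quartic_pos hp a).le
    have hβ := sq_sqrt (quartic_pos hp b).le
    have hQ := quartic_pos hq1 (a * b)
    have hφ : (m / √(1 + 2 * q * (a * b) ^ 2 + (a * b) ^ 4)) ^ 2
        = 2 * p * (1 + 2 * q * (a * b) ^ 2 + (a * b) ^ 4)⁻¹ := by
      rw [div_pow, sq_sqrt hQ.le, hm, div_eq_mul_inv]
    have hmse := minimal_surface_identity (k := c * r) hq hα hβ (inv_mul_cancel₀ hQ.ne') hφ hc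
      _ _ _ rfl rfl rfl
    refine Eq.trans ?_ hmse
    simp only [div_eq_mul_inv]
    ring
  · rw [hpu _ h0]
    simp [G, hA0]
  · rw [hpv _ h0]
    simp [G, hA0]
  · rw [hpuu _ h0]
    simp [hA0]
    ring
  · rw [hpvu _ h0]
    simp [hA0]
  · rw [hpvv _ h0]
    simp [hA0]
    ring

/-- For every `0 ≤ κ < π²/2` there exists a minimal graph over the
unit disk with `f(0,0) = 0`, vanishing gradient at the origin (so the unit normal
there is `(0,0,1)`), `f_uv(0,0) = 0` (bending in the coordinate directions at the
origin), whose Gaussian curvature at the origin satisfies `|K| = κ` exactly. -/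
theorem exists_minimal_graph_curvature_eq (κ : ℝ) (hκ0 : 0 ≤ κ) (hκ : κ < π ^ 2 / 2) :
    ∃ f : ℝ × ℝ → ℝ, IsMinimalGraph f ∧
      f ((0 : ℝ), (0 : ℝ)) = 0 ∧
      pu f ((0 : ℝ), (0 : ℝ)) = 0 ∧ pv f ((0 : ℝ), (0 : ℝ)) = 0 ∧
      pv (pu f) ((0 : ℝ), (0 : ℝ)) = 0 ∧
      |pu (pu f) ((0 : ℝ), (0 : ℝ)) * pv (pv f) ((0 : ℝ), (0 : ℝ))
          - (pv (pu f) ((0 : ℝ), (0 : ℝ))) ^ 2|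
        / (1 + (pu f ((0 : ℝ), (0 : ℝ))) ^ 2 + (pv f ((0 : ℝ), (0 : ℝ))) ^ 2) ^ 2
      = κ := by
  have hπ := pi_pos
  set p := 2 * κ / π ^ 2 with hp_def
  have hp0 : 0 ≤ p := by positivity
  have hp1 : p < 1 := by
    rw [hp_def, div_lt_one (by positivity)]
    linarith
  have hq1 : -1 < 1 - 2 * p ^ 2 := by nlinarith
  have hm : √(2 * p) ^ 2 = 2 * p := sq_sqrt (by linarith)
  have hc : 2 * (√(1 / 2)) ^ 2 = 1 := by rw [sq_sqrt (by norm_num)]; norm_num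
  obtain ⟨F, hF0, hFC, hF⟩ := exists_primitive_quartic hq1 √(2 * p)
  obtain ⟨A, hA0, hAC, hA⟩ := exists_elliptic_tangent hp0 hp1.le
  obtain ⟨hmin, hu, hv, huu, huv, hvv⟩ := isMinimalGraph_elliptic (by linarith) hq1 rfl hm hc
    (half_pos hπ) hFC hF hA0 hAC hA rfl
  refine ⟨_, hmin, ?_, hu, hv, huv, ?_⟩
  · simp [hA0, hF0]
  · rw [hu, hv, huu, huv, hvv, hc]
    have hK : 1 * (π / 2) * √(2 * p) * -(1 * (π / 2) * √(2 * p)) - 0 ^ 2 = -κ := by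
      have hκp : p * π ^ 2 = 2 * κ := by rw [hp_def]; field_simp
      linear_combination -(π / 2) ^ 2 * hm - hκp / 2
    rw [hK, abs_neg, abs_of_nonneg hκ0]
    norm_num
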